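/- arXiv:hep-th/9512160 — 9 statements merged into one kernel-verified Lean document; each statement's English description precedes it below -/
import Mathlib

section
/- For every natural number l and all real numbers z₂ < z₁ and z₃ with z₃ ∉ [z₂, z₁], one has ((2l+1)!/(l!)²) · ∫_{z₂}^{z₁} (z₁ − z)^l (z − z₂)^l / (z − z₃)^{2l+2} dz = (z₁ − z₂)^{2l+1} / ((z₁ − z₃)(z₂ − z₃))^{l+1}. (This is the integral formula (1.23), which identifies the kernel in the quasiprimary expansion of the bilocal field with the Möbius-invariant 3-point function.) -/
open intervalIntegral

/-- The Beta integral at natural exponents. -/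
theorem integral_pow_mul_one_sub_pow (m n : ℕ) :
    ∫ x in (0 : ℝ)..1, x ^ m * (1 - x) ^ n =
      (Nat.factorial m * Nat.factorial n : ℝ) / Nat.factorial (m + n + 1) := by
  have hpos (k : ℕ) : 0 < ((k : ℂ) + 1).re := by
    rw [Complex.add_re, Complex.natCast_re, Complex.one_re]
    positivity
  have hG := Complex.Gamma_mul_Gamma_eq_betaIntegral (hpos m) (hpos n)
  have hsum : (m : ℂ) + 1 + (n + 1) = ((m + n + 1 : ℕ) : ℂ) + 1 := by push_cast; ring
  have hB : Complex.betaIntegral ((m : ℂ) + 1) ((n : ℂ) + 1) =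
      ((∫ x in (0 : ℝ)..1, x ^ m * (1 - x) ^ n : ℝ) : ℂ) := by
    rw [Complex.betaIntegral, ← intervalIntegral.integral_ofReal]
    simp
  rw [hsum, Complex.Gamma_nat_eq_factorial, Complex.Gamma_nat_eq_factorial,
    Complex.Gamma_nat_eq_factorial, hB] at hG
  rw [eq_div_iff (by positivity), mul_comm]
  exact_mod_cast hG.symm

/-- The integral formula (1.23):
((2l+1)!/(l!)²) · ∫_{z₂}^{z₁} (z₁−z)^l (z−z₂)^l / (z−z₃)^{2l+2} dz
  = (z₁−z₂)^{2l+1} / ((z₁−z₃)(z₂−z₃))^{l+1}. -/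
theorem integral_formula_quasiprimary_kernel (l : ℕ) (z₁ z₂ z₃ : ℝ)
    (h : z₂ < z₁) (h3 : z₃ ∉ Set.Icc z₂ z₁) :
    ((Nat.factorial (2 * l + 1) : ℝ) / (Nat.factorial l : ℝ) ^ 2) *
      ∫ z in z₂..z₁, (z₁ - z) ^ l * (z - z₂) ^ l / (z - z₃) ^ (2 * l + 2) =
    (z₁ - z₂) ^ (2 * l + 1) / ((z₁ - z₃) * (z₂ - z₃)) ^ (l + 1) := by
  have hne : ∀ z ∈ Set.uIcc z₂ z₁, z - z₃ ≠ 0 := by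
    intro z hz h0
    rw [Set.uIcc_of_le h.le] at hz
    exact h3 (sub_eq_zero.mp h0 ▸ hz)
  have h12 : z₁ - z₂ ≠ 0 := (sub_pos.mpr h).ne'
  have h13 : z₁ - z₃ ≠ 0 := hne z₁ Set.right_mem_uIcc
  have h23 : z₂ - z₃ ≠ 0 := hne z₂ Set.left_mem_uIcc
  set f : ℝ → ℝ := fun z => (z - z₂) * (z₁ - z₃) / ((z₁ - z₂) * (z - z₃)) with hf
  set f' : ℝ → ℝ := fun z => (z₁ - z₃) * (z₂ - z₃) / ((z₁ - z₂) * (z - z₃) ^ 2) with hf'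
  have hderiv : ∀ z ∈ Set.uIcc z₂ z₁, HasDerivAt f (f' z) z := by
    intro z hz
    have hz3 := hne z hz
    have hd := (((hasDerivAt_id z).sub_const z₂).mul_const (z₁ - z₃)).div
      (((hasDerivAt_id z).sub_const z₃).const_mul (z₁ - z₂)) (mul_ne_zero h12 hz3)
    refine hd.congr_deriv ?_
    simp only [hf', id]
    field_simp
    ring
  have hcont : ContinuousOn f' (Set.uIcc z₂ z₁) := by
    refine ContinuousOn.div (by fun_prop) (by fun_prop) fun z hz => ?_
    exact mul_ne_zero h12 (pow_ne_zero _ (hne z hz))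
  have hsubst := intervalIntegral.integral_comp_mul_deriv (g := fun t => t ^ l * (1 - t) ^ l)
    hderiv hcont (by fun_prop)
  have hf2 : f z₂ = 0 := by simp [hf]
  have hf1 : f z₁ = 1 := by
    simp only [hf]
    field_simp
  rw [hf2, hf1, integral_pow_mul_one_sub_pow] at hsubst
  have hintegrand : ∀ z ∈ Set.uIcc z₂ z₁,
      (z₁ - z) ^ l * (z - z₂) ^ l / (z - z₃) ^ (2 * l + 2) =
        (z₁ - z₂) ^ (2 * l + 1) / ((z₁ - z₃) * (z₂ - z₃)) ^ (l + 1) *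
          (((fun t => t ^ l * (1 - t) ^ l) ∘ f) z * f' z) := by
    intro z hz
    have hz3 := hne z hz
    have hsub : 1 - f z = (z₁ - z) * (z₂ - z₃) / ((z₁ - z₂) * (z - z₃)) := by
      simp only [hf]
      field_simp
      ring
    simp only [Function.comp_apply, hsub]
    simp only [hf, hf', div_pow, mul_pow]
    field_simp
    ring
  rw [intervalIntegral.integral_congr hintegrand, intervalIntegral.integral_const_mul, hsubst,
    ← two_mul]
  have hl : (Nat.factorial l : ℝ) ≠ 0 := by positivity
  have hl' : (Nat.factorial (2 * l + 1) : ℝ) ≠ 0 := by positivity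
  field_simp
end

section
/- For every real η with |η| < 1, one has 1/(1−η) = 1 + Σ_{l=1}^{∞} C(2l−2, l−1)^{−1} · η^l · ₂F₁(l, l; 2l; η), where the series over l converges. (Identity (1.24), which shows that the quasiprimary expansion of the bilocal field V reproduces its 4-point function.) -/
noncomputable section

/-- Rising factorial (Pochhammer symbol) (x)_n = x(x+1)⋯(x+n−1). -/
def risingFac (x : ℝ) (n : ℕ) : ℝ := ∏ i ∈ Finset.range n, (x + i)

/-- The Gauss hypergeometric function ₂F₁(a,b;c;η), defined by its power
series (convergent for |η| < 1). -/
def hyperF (a b c η : ℝ) : ℝ :=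
  ∑' n : ℕ, risingFac a n * risingFac b n /
    (risingFac c n * (Nat.factorial n : ℝ)) * η ^ n

theorem risingFac_natCast_add_one (k n : ℕ) :
    risingFac ((k : ℝ) + 1) n = ((k + n).factorial : ℝ) / (k.factorial : ℝ) := by
  have hk : (k.factorial : ℝ) ≠ 0 := by positivity
  rw [eq_div_iff hk]
  induction n with
  | zero => simp [risingFac]
  | succ n ih =>
    have hs : risingFac ((k : ℝ) + 1) (n + 1) = risingFac ((k : ℝ) + 1) n * ((k : ℝ) + 1 + n) :=
      Finset.prod_range_succ _ _
    rw [hs, ← add_assoc, Nat.factorial_succ]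
    push_cast
    rw [← ih]
    ring

/-- The coefficient of `η ^ (l + n + 1)` in `C(2l,l)⁻¹ η ^ (l + 1) ₂F₁(l + 1, l + 1; 2l + 2; η)`. -/
def blockCoeff (l n : ℕ) : ℝ :=
  (2 * l + 1) * ((l + n).factorial : ℝ) ^ 2 /
    (((2 * l + 1 + n).factorial : ℝ) * (n.factorial : ℝ))

theorem blockCoeff_nonneg (l n : ℕ) : 0 ≤ blockCoeff l n := by
  unfold blockCoeff
  positivity

theorem inv_centralBinom_mul_hyperF (l : ℕ) (η : ℝ) :
    ((Nat.choose (2 * l) l : ℝ))⁻¹ * η ^ (l + 1) *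
      hyperF ((l : ℝ) + 1) ((l : ℝ) + 1) (2 * (l : ℝ) + 2) η =
      ∑' n : ℕ, blockCoeff l n * η ^ (l + n + 1) := by
  have hc : (2 * (l : ℝ) + 2) = ((2 * l + 1 : ℕ) : ℝ) + 1 := by push_cast; ring
  have hb : (Nat.choose (2 * l) l : ℝ) = ((2 * l).factorial : ℝ) / (l.factorial : ℝ) ^ 2 := by
    rw [Nat.cast_choose ℝ (by omega), show 2 * l - l = l by omega, sq]
  unfold hyperF
  rw [← tsum_mul_left]
  refine tsum_congr fun n => ?_
  rw [hc, risingFac_natCast_add_one, risingFac_natCast_add_one, hb, blockCoeff,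
    Nat.factorial_succ (2 * l)]
  have h1 : (l.factorial : ℝ) ≠ 0 := by positivity
  have h2 : ((2 * l).factorial : ℝ) ≠ 0 := by positivity
  have h3 : ((2 * l + 1 + n).factorial : ℝ) ≠ 0 := by positivity
  have h4 : (n.factorial : ℝ) ≠ 0 := by positivity
  push_cast
  field_simp
  ring

theorem sum_range_blockCoeff (k j : ℕ) :
    ∑ p ∈ Finset.range k, blockCoeff p (k + j - p) =
      1 - ((k + j).factorial : ℝ) ^ 2 / (((2 * k + j).factorial : ℝ) * (j.factorial : ℝ)) := by
  induction k generalizing j with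
  | zero =>
    have : (j.factorial : ℝ) ≠ 0 := by positivity
    simp
    field_simp
    simp
  | succ k ih =>
    have e : k + 1 + j = k + (j + 1) := by ring
    rw [Finset.sum_range_succ, e, ih, show k + (j + 1) - k = j + 1 by omega, blockCoeff,
      show 2 * k + 1 + (j + 1) = (2 * k + j + 1) + 1 by ring,
      show 2 * (k + 1) + j = (2 * k + j + 1) + 1 by ring,
      show 2 * k + (j + 1) = 2 * k + j + 1 by ring,
      Nat.factorial_succ (2 * k + j + 1), Nat.factorial_succ j]
    have h1 : ((2 * k + j + 1).factorial : ℝ) ≠ 0 := by positivity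
    have h2 : (j.factorial : ℝ) ≠ 0 := by positivity
    push_cast
    field_simp
    ring

theorem sum_antidiagonal_blockCoeff (m : ℕ) :
    ∑ p ∈ Finset.HasAntidiagonal.antidiagonal m, blockCoeff p.1 p.2 = 1 := by
  rw [Finset.Nat.sum_antidiagonal_eq_sum_range_succ_mk, Finset.sum_range_succ]
  have h := sum_range_blockCoeff m 0
  simp only [add_zero] at h
  rw [h, Nat.sub_self, blockCoeff, add_zero, add_zero, Nat.factorial_succ (2 * m)]
  have h1 : ((2 * m).factorial : ℝ) ≠ 0 := by positivity
  push_cast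
  field_simp
  simp

theorem sum_antidiagonal_blockCoeff_mul_pow (m : ℕ) (x : ℝ) :
    ∑ p ∈ Finset.HasAntidiagonal.antidiagonal m, blockCoeff p.1 p.2 * x ^ (p.1 + p.2 + 1) = x ^ (m + 1) := by
  rw [← one_mul (x ^ (m + 1)), ← sum_antidiagonal_blockCoeff m, Finset.sum_mul]
  refine Finset.sum_congr rfl fun p hp => ?_
  rw [Finset.HasAntidiagonal.mem_antidiagonal.mp hp]

theorem summable_blockCoeff_mul_pow {η : ℝ} (hη : |η| < 1) :
    Summable fun p : ℕ × ℕ => blockCoeff p.1 p.2 * η ^ (p.1 + p.2 + 1) := by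
  apply Summable.of_norm
  rw [← Finset.HasAntidiagonal.sigmaAntidiagonalEquivProd.summable_iff]
  refine (summable_sigma_of_nonneg fun _ => norm_nonneg _).mpr ?_
  refine ⟨fun m => (hasSum_fintype _).summable, ?_⟩
  have hs : Summable fun m : ℕ => |η| ^ (m + 1) :=
    (summable_nat_add_iff 1).mpr (summable_geometric_of_lt_one (abs_nonneg η) hη)
  refine hs.congr fun m => ?_
  rw [tsum_fintype, ← sum_antidiagonal_blockCoeff_mul_pow m |η|, ← Finset.sum_coe_sort]
  refine Finset.sum_congr rfl fun p _ => ?_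
  simp [abs_of_nonneg (blockCoeff_nonneg _ _)]

theorem hasSum_blockCoeff_mul_pow {η : ℝ} (hη : |η| < 1) :
    HasSum (fun p : ℕ × ℕ => blockCoeff p.1 p.2 * η ^ (p.1 + p.2 + 1)) (1 / (1 - η) - 1) := by
  have hd := (Finset.HasAntidiagonal.sigmaAntidiagonalEquivProd.hasSum_iff.mpr
    (summable_blockCoeff_mul_pow hη).hasSum).sigma fun m => hasSum_fintype _
  have hg : HasSum (fun m : ℕ => η ^ (m + 1)) (1 / (1 - η) - 1) := by
    simpa using (hasSum_nat_add_iff' 1).mpr (hasSum_geometric_of_abs_lt_one hη)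
  rw [← hd.unique (hg.congr_fun fun m => ?_)]
  · exact (summable_blockCoeff_mul_pow hη).hasSum
  · rw [← sum_antidiagonal_blockCoeff_mul_pow m η]
    exact Finset.sum_coe_sort (Finset.HasAntidiagonal.antidiagonal m)
      fun p => blockCoeff p.1 p.2 * η ^ (p.1 + p.2 + 1)

/-- Identity (1.24): 1/(1−η) = 1 + Σ_{l=1}^{∞} C(2l−2,l−1)⁻¹ η^l ₂F₁(l,l;2l;η)
for |η| < 1 (the series over l, here reindexed by l ↦ l+1, converges). -/
theorem one_div_one_sub_eq_sum_hypergeometric (η : ℝ) (hη : |η| < 1) :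
    HasSum
      (fun l : ℕ =>
        ((Nat.choose (2 * l) l : ℝ))⁻¹ * η ^ (l + 1) *
          hyperF ((l : ℝ) + 1) ((l : ℝ) + 1) (2 * (l : ℝ) + 2) η)
      (1 / (1 - η) - 1) := by
  simp_rw [inv_centralBinom_mul_hyperF]
  exact (hasSum_blockCoeff_mul_pow hη).prod_fiberwise fun l =>
    ((summable_blockCoeff_mul_pow hη).prod_factor l).hasSum
end
end

section
/- For every natural number l, the homogeneous polynomial 𝒟_l(α,β) = C(2l,l)^{−1} · Σ_{k=0}^{l} C(l,k)² α^k (−β)^{l−k} of degree l satisfies the partial differential equation α·∂²𝒟_l/∂α² + β·∂²𝒟_l/∂β² + ∂𝒟_l/∂α + ∂𝒟_l/∂β = 0 together with the normalization 𝒟_l(1,−1) = 1. (Existence part of the characterization (1.28a)–(1.28b) of the derivative operator extracting the quasiprimary field V^l from the bilocal field.) -/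
noncomputable section

/-- The homogeneous polynomial
𝒟_l(α,β) = C(2l,l)⁻¹ Σ_{k=0}^{l} C(l,k)² α^k (−β)^{l−k}. -/
def Dl (l : ℕ) (α β : ℝ) : ℝ :=
  ((Nat.choose (2 * l) l : ℝ))⁻¹ *
    ∑ k ∈ Finset.range (l + 1),
      (Nat.choose l k : ℝ) ^ 2 * α ^ k * (-β) ^ (l - k)

theorem deriv_sum_mul_pow {ι : Type*} (s : Finset ι) (c : ι → ℝ) (e : ι → ℕ) :
    deriv (fun x : ℝ => ∑ i ∈ s, c i * x ^ e i) =
      fun x => ∑ i ∈ s, c i * e i * x ^ (e i - 1) := by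
  funext x
  refine (HasDerivAt.fun_sum fun i _ => ?_).deriv
  simpa [mul_assoc] using (hasDerivAt_pow (e i) x).const_mul (c i)

/-- The operator `x ∂² + ∂` maps `x ^ n` to `n ^ 2 * x ^ (n - 1)`. -/
theorem mul_deriv_deriv_add_deriv_sum_mul_pow {ι : Type*} (s : Finset ι) (c : ι → ℝ)
    (e : ι → ℕ) (x : ℝ) :
    x * deriv (deriv fun x : ℝ => ∑ i ∈ s, c i * x ^ e i) x +
        deriv (fun x : ℝ => ∑ i ∈ s, c i * x ^ e i) x =
      ∑ i ∈ s, c i * (e i : ℝ) ^ 2 * x ^ (e i - 1) := by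
  rw [deriv_sum_mul_pow, deriv_sum_mul_pow s (fun i => c i * e i) (fun i => e i - 1),
    Finset.mul_sum, ← Finset.sum_add_distrib]
  refine Finset.sum_congr rfl fun i _ => ?_
  rcases e i with _ | _ | n
  · simp
  · simp
  · simp only [Nat.add_sub_cancel]
    push_cast
    ring

theorem mul_deriv_deriv_add_deriv_comp_neg (g : ℝ → ℝ) (x : ℝ) :
    x * deriv (deriv fun y => g (-y)) x + deriv (fun y => g (-y)) x =
      -(-x * deriv (deriv g) (-x) + deriv g (-x)) := by
  have h : (deriv fun y => g (-y)) = fun y => -deriv g (-y) :=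
    funext fun y => deriv_comp_neg g y
  rw [h, deriv.fun_neg, deriv_comp_neg (deriv g) x]
  ring

/-- The contributions of the two variables to the differential equation cancel. -/
theorem sum_choose_sq_mul_sq_mul_pow_pred (l : ℕ) (x y : ℝ) :
    ∑ k ∈ Finset.range (l + 1),
        (l.choose k : ℝ) ^ 2 * (k : ℝ) ^ 2 * x ^ (k - 1) * y ^ (l - k) =
      ∑ k ∈ Finset.range (l + 1),
        (l.choose k : ℝ) ^ 2 * ((l - k : ℕ) : ℝ) ^ 2 * x ^ k * y ^ (l - k - 1) := by
  rw [Finset.sum_range_succ', Finset.sum_range_succ]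
  simp only [Nat.sub_self, Nat.cast_zero, Nat.add_sub_cancel]
  have h (k : ℕ) : (l.choose (k + 1) : ℝ) * (k + 1 : ℕ) = l.choose k * (l - k : ℕ) :=
    mod_cast Nat.choose_succ_right_eq l k
  simp [← mul_pow, ← h, Nat.sub_sub]

/-- Existence part of (1.28a)–(1.28b): 𝒟_l satisfies the PDE
α·∂²𝒟/∂α² + β·∂²𝒟/∂β² + ∂𝒟/∂α + ∂𝒟/∂β = 0 and 𝒟_l(1,−1) = 1. -/
theorem Dl_satisfies_pde_and_normalization (l : ℕ) :
    (∀ α β : ℝ,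
      α * deriv (deriv fun a => Dl l a β) α +
        β * deriv (deriv fun b => Dl l α b) β +
        deriv (fun a => Dl l a β) α + deriv (fun b => Dl l α b) β = 0) ∧
    Dl l 1 (-1) = 1 := by
  constructor
  · intro α β
    have hα := mul_deriv_deriv_add_deriv_sum_mul_pow (Finset.range (l + 1))
      (fun k => ((2 * l).choose l : ℝ)⁻¹ * (l.choose k : ℝ) ^ 2 * (-β) ^ (l - k))
      (fun k => k) α
    have hβ := mul_deriv_deriv_add_deriv_sum_mul_pow (Finset.range (l + 1))
      (fun k => ((2 * l).choose l : ℝ)⁻¹ * (l.choose k : ℝ) ^ 2 * α ^ k)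
      (fun k => l - k) (-β)
    have hDα : (fun a => Dl l a β) = fun a => ∑ k ∈ Finset.range (l + 1),
        ((2 * l).choose l : ℝ)⁻¹ * (l.choose k : ℝ) ^ 2 * (-β) ^ (l - k) * a ^ k := by
      funext a
      rw [Dl, Finset.mul_sum]
      exact Finset.sum_congr rfl fun k _ => by ring
    have hDβ : (fun b => Dl l α b) = fun b => ∑ k ∈ Finset.range (l + 1),
        ((2 * l).choose l : ℝ)⁻¹ * (l.choose k : ℝ) ^ 2 * α ^ k * (-b) ^ (l - k) := by
      funext b
      rw [Dl, Finset.mul_sum]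
      exact Finset.sum_congr rfl fun k _ => by ring
    have hneg := mul_deriv_deriv_add_deriv_comp_neg (fun b => ∑ k ∈ Finset.range (l + 1),
      ((2 * l).choose l : ℝ)⁻¹ * (l.choose k : ℝ) ^ 2 * α ^ k * b ^ (l - k)) β
    rw [hβ, ← hDβ] at hneg
    rw [← hDα] at hα
    have hcancel := congrArg (((2 * l).choose l : ℝ)⁻¹ * ·)
      (sum_choose_sq_mul_sq_mul_pow_pred l α (-β))
    simp only [Finset.mul_sum] at hcancel
    have hsum : ∑ k ∈ Finset.range (l + 1), ((2 * l).choose l : ℝ)⁻¹ * (l.choose k : ℝ) ^ 2 *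
          (-β) ^ (l - k) * (k : ℝ) ^ 2 * α ^ (k - 1) =
        ∑ k ∈ Finset.range (l + 1), ((2 * l).choose l : ℝ)⁻¹ * (l.choose k : ℝ) ^ 2 *
          α ^ k * ((l - k : ℕ) : ℝ) ^ 2 * (-β) ^ (l - k - 1) := by
      convert hcancel using 2 <;> ring
    linarith
  · have hpos : ((2 * l).choose l : ℝ) ≠ 0 :=
      mod_cast (Nat.choose_pos (by omega : l ≤ 2 * l)).ne'
    have hsum : ∑ k ∈ Finset.range (l + 1), (l.choose k : ℝ) ^ 2 = (2 * l).choose l :=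
      mod_cast Nat.sum_range_choose_sq l
    simp [Dl, hsum, hpos]
end
end

section
/- Let F : ℝ² → ℝ be a C^∞ function, l a natural number, and z ∈ ℝ. Then (1/l!) · ∂₁^l(−∂₂)^l [ (z₁−z₂)^l F(z₁,z₂) ] evaluated at z₁ = z₂ = z equals Σ_{k=0}^{l} C(l,k)² (∂₁^k(−∂₂)^{l−k} F)(z,z), where ∂₁, ∂₂ denote partial derivatives in the first and second argument. (The equivalence of the two extraction formulas (1.20a) and (1.20b) for the quasiprimary field V^l.) -/
noncomputable section

/-- Partial derivative in the first argument of a function of two real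
variables. -/
def pd1 (F : ℝ × ℝ → ℝ) : ℝ × ℝ → ℝ :=
  fun p => deriv (fun x => F (x, p.2)) p.1

/-- Partial derivative in the second argument of a function of two real
variables. -/
def pd2 (F : ℝ × ℝ → ℝ) : ℝ × ℝ → ℝ :=
  fun p => deriv (fun y => F (p.1, y)) p.2

theorem pd1_iterate_apply (n : ℕ) (F : ℝ × ℝ → ℝ) (p : ℝ × ℝ) :
    (pd1^[n] F) p = iteratedDeriv n (fun x => F (x, p.2)) p.1 := by
  induction n generalizing F with
  | zero => simp
  | succ n ih =>
    rw [Function.iterate_succ_apply, ih, iteratedDeriv_succ']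
    rfl

theorem pd2_iterate_apply (n : ℕ) (F : ℝ × ℝ → ℝ) (p : ℝ × ℝ) :
    (pd2^[n] F) p = iteratedDeriv n (fun y => F (p.1, y)) p.2 := by
  induction n generalizing F with
  | zero => simp
  | succ n ih =>
    rw [Function.iterate_succ_apply, ih, iteratedDeriv_succ']
    rfl

theorem contDiff_pd2 {F : ℝ × ℝ → ℝ} (hF : ContDiff ℝ (⊤ : ℕ∞) F) :
    ContDiff ℝ (⊤ : ℕ∞) (pd2 F) := by
  have h : pd2 F = fun p => fderiv ℝ F p (0, 1) := by
    funext p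
    have hd : HasDerivAt (fun y : ℝ => (p.1, y)) ((0 : ℝ), (1 : ℝ)) p.2 :=
      (hasDerivAt_const p.2 p.1).prodMk (hasDerivAt_id p.2)
    have hf : HasFDerivAt F (fderiv ℝ F p) (p.1, p.2) :=
      (hF.differentiable (by simp) p).hasFDerivAt
    exact (hf.comp_hasDerivAt p.2 hd).deriv
  rw [h]
  exact (hF.fderiv_right (by simp)).clm_apply contDiff_const

theorem contDiff_pd2_iterate {F : ℝ × ℝ → ℝ} (hF : ContDiff ℝ (⊤ : ℕ∞) F) (n : ℕ) :
    ContDiff ℝ (⊤ : ℕ∞) (pd2^[n] F) := by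
  induction n with
  | zero => exact hF
  | succ n ih =>
    rw [Function.iterate_succ_apply']
    exact contDiff_pd2 ih

/-- Iterated derivative of `(x - c) ^ m * g x` at the base point `c`. -/
theorem iteratedDeriv_sub_pow_mul_self {n m : ℕ} (hmn : m ≤ n) {g : ℝ → ℝ} {c : ℝ}
    (hg : ContDiffAt ℝ n g c) :
    iteratedDeriv n (fun x => (x - c) ^ m * g x) c =
      n.choose m * m.factorial * iteratedDeriv (n - m) g c := by
  rw [iteratedDeriv_fun_mul (by fun_prop) hg, Finset.sum_eq_single m]
  · rw [iteratedDeriv_comp_sub_const m (fun x : ℝ => x ^ m) c]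
    simp [Nat.descFactorial_self]
  · intro i _ him
    rw [iteratedDeriv_comp_sub_const i (fun x : ℝ => x ^ m) c]
    simp only [sub_self, iteratedDeriv_fun_pow_zero, if_neg him, Nat.cast_zero, mul_zero, zero_mul]
  · intro h
    simp at h
    omega

/-- Leibniz rule for `∂₂ ^ l` applied to `(z₁ - z₂) ^ l * F`. -/
theorem pd2_iterate_sub_pow_mul {F : ℝ × ℝ → ℝ} (hF : ContDiff ℝ (⊤ : ℕ∞) F) (l : ℕ)
    (p : ℝ × ℝ) :
    (pd2^[l] fun q => (q.1 - q.2) ^ l * F q) p =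
      ∑ j ∈ Finset.range (l + 1), (l.choose j * (-1) ^ j * l.descFactorial j : ℝ) *
        ((p.1 - p.2) ^ (l - j) * (pd2^[l - j] F) p) := by
  have hs : ContDiff ℝ l fun y => F (p.1, y) :=
    (hF.of_le (by exact_mod_cast le_top)).comp (by fun_prop)
  rw [pd2_iterate_apply, iteratedDeriv_fun_mul (by fun_prop) hs.contDiffAt]
  refine Finset.sum_congr rfl fun j _ => ?_
  rw [iteratedDeriv_comp_const_sub j (fun x : ℝ => x ^ l) p.1, pd2_iterate_apply]
  simp only [iteratedDeriv_pow, smul_eq_mul]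
  ring

/-- Equivalence of the two extraction formulas (1.20a) and (1.20b):
(1/l!) ∂₁^l(−∂₂)^l[(z₁−z₂)^l F(z₁,z₂)] |_{z₁=z₂=z}
  = Σ_{k=0}^{l} C(l,k)² (∂₁^k(−∂₂)^{l−k} F)(z,z). -/
theorem extraction_formulas_equivalent (F : ℝ × ℝ → ℝ)
    (hF : ContDiff ℝ (⊤ : ℕ∞) F) (l : ℕ) (z : ℝ) :
    (1 / (Nat.factorial l : ℝ)) *
        ((-1 : ℝ) ^ l *
          (pd1^[l] (pd2^[l] fun p => (p.1 - p.2) ^ l * F p)) (z, z)) =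
      ∑ k ∈ Finset.range (l + 1),
        (Nat.choose l k : ℝ) ^ 2 * (-1 : ℝ) ^ (l - k) *
          (pd1^[k] (pd2^[l - k] F)) (z, z) := by
  have hG (m n : ℕ) : ContDiff ℝ n fun x => (pd2^[m] F) (x, z) :=
    ((contDiff_pd2_iterate hF m).of_le (by exact_mod_cast le_top)).comp (by fun_prop)
  rw [pd1_iterate_apply]
  simp only [pd2_iterate_sub_pow_mul hF]
  rw [iteratedDeriv_fun_sum fun j _ => by
    have := (hG (l - j) l).contDiffAt (x := z)
    fun_prop, Finset.mul_sum, Finset.mul_sum]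
  refine Finset.sum_congr rfl fun j hj => ?_
  have hjl : j ≤ l := Nat.lt_succ_iff.mp (Finset.mem_range.mp hj)
  rw [iteratedDeriv_const_mul_field,
    iteratedDeriv_sub_pow_mul_self (Nat.sub_le l j) (hG _ l).contDiffAt,
    Nat.sub_sub_self hjl, Nat.choose_symm hjl, pd1_iterate_apply]
  have hfac : ((l - j).factorial : ℝ) * l.descFactorial j = l.factorial := by
    exact_mod_cast Nat.factorial_mul_descFactorial hjl
  have hsign : (-1 : ℝ) ^ l * (-1) ^ j = (-1) ^ (l - j) := by
    obtain ⟨i, rfl⟩ := Nat.exists_eq_add_of_le hjl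
    rw [Nat.add_sub_cancel_left, pow_add, mul_right_comm, ← mul_pow]
    simp
  have hl : (l.factorial : ℝ) ≠ 0 := by exact_mod_cast l.factorial_ne_zero
  rw [← hsign]
  field_simp
  rw [← hfac]
  ring
end
end

section
/- Let F : ℝ² → ℝ be a C^∞ function and l a natural number. For z ∈ ℝ define J^m[F](z) = (∂₁^m F)(z,z) (the m-th derivative in the first argument evaluated on the diagonal). Then Σ_{k=0}^{l} C(l,k)² (∂₁^k(−∂₂)^{l−k}F)(z,z) = Σ_{k=0}^{l} (−1)^k C(l,k) C(2l−k, l) (d/dz)^k [ J^{l−k}[F] ](z) for every z ∈ ℝ, where (d/dz)^k is the k-th total derivative of the diagonal function z ↦ (∂₁^{l−k}F)(z,z). (This is Lemma 1.3, formula (1.32), expressing the quasiprimary combination in terms of the Taylor-expansion fields J^m and their derivatives.) -/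
noncomputable section

open scoped ContDiff

theorem sum_choose_mul_choose_sub {l m : ℕ} (hm : m ≤ l) :
    ∑ k ∈ Finset.range (l + 1), l.choose k * (l - m).choose k = (2 * l - m).choose l := by
  rw [show 2 * l - m = (l - m) + l by omega, Nat.add_choose_eq,
    Finset.Nat.sum_antidiagonal_eq_sum_range_succ_mk]
  refine Finset.sum_congr rfl fun k hk => ?_
  rw [Nat.choose_symm (Finset.mem_range_succ_iff.mp hk), mul_comm]

theorem choose_mul_choose_sub_comm (l k m : ℕ) :
    l.choose k * (l - k).choose m = l.choose m * (l - m).choose k := by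
  by_cases h : k + m ≤ l
  · have h₁ := Nat.choose_mul (n := l) (Nat.le_add_right k m)
    have h₂ := Nat.choose_mul (n := l) (Nat.le_add_left m k)
    rw [Nat.add_sub_cancel_left] at h₁
    rw [Nat.add_sub_cancel_right] at h₂
    rw [← h₁, ← h₂, Nat.choose_symm_add]
  · push Not at h
    rcases le_or_gt k l with hk | hk
    · rw [Nat.choose_eq_zero_of_lt (show l - k < m by omega)]
      rcases le_or_gt m l with hm | hm
      · rw [Nat.choose_eq_zero_of_lt (show l - m < k by omega)]; simp
      · rw [Nat.choose_eq_zero_of_lt hm]; simp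
    · rw [Nat.choose_eq_zero_of_lt hk, Nat.choose_eq_zero_of_lt (show l - m < k by omega)]; simp

theorem Commute.sum_choose_sq_smul_pow_mul_neg_pow {R : Type*} [Ring R] {a b : R}
    (h : Commute a b) (l : ℕ) :
    ∑ k ∈ Finset.range (l + 1), l.choose k ^ 2 • (a ^ k * (-b) ^ (l - k)) =
      ∑ m ∈ Finset.range (l + 1),
        (l.choose m * (2 * l - m).choose l) • ((-(a + b)) ^ m * a ^ (l - m)) := by
  have hs : Commute (-(a + b)) a := ((Commute.refl a).add_left h.symm).neg_left
  have expand (k : ℕ) : (-b) ^ (l - k) = ∑ m ∈ Finset.range (l + 1),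
      (l - k).choose m • ((-(a + b)) ^ m * a ^ (l - k - m)) := by
    rw [show -b = -(a + b) + a by abel, hs.add_pow]
    simp only [← nsmul_eq_mul']
    refine Finset.sum_subset (Finset.range_mono (show l - k + 1 ≤ l + 1 by omega)) fun m _ hm => ?_
    rw [Nat.choose_eq_zero_of_lt (not_le.mp fun h => hm
      (Finset.mem_range_succ_iff.mpr h)), zero_smul]
  simp only [expand, Finset.mul_sum, Finset.smul_sum]
  rw [Finset.sum_comm]
  refine Finset.sum_congr rfl fun m hm => ?_
  rw [← sum_choose_mul_choose_sub (Finset.mem_range_succ_iff.mp hm), Finset.mul_sum,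
    Finset.sum_smul]
  refine Finset.sum_congr rfl fun k _ => ?_
  have hc : l.choose k ^ 2 * (l - k).choose m =
      l.choose m * (l.choose k * (l - m).choose k) := by
    rw [sq, mul_assoc, choose_mul_choose_sub_comm, mul_left_comm]
  rw [mul_smul_comm, smul_smul, hc]
  by_cases hkm : k ≤ l - m
  · rw [← mul_assoc (a ^ k), ← (hs.pow_pow m k).eq, mul_assoc (_ ^ m), ← pow_add]
    rw [show k + (l - k - m) = l - m by
      have := Finset.mem_range_succ_iff.mp hm
      omega]
  · rw [Nat.choose_eq_zero_of_lt (not_le.mp hkm)]; simp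

theorem Commute.sum_neg_one_pow_choose_sq_smul_pow_mul_pow {R : Type*} [Ring R] {a b : R}
    (h : Commute a b) (l : ℕ) :
    ∑ k ∈ Finset.range (l + 1),
        ((l.choose k : ℤ) ^ 2 * (-1) ^ (l - k)) • (a ^ k * b ^ (l - k)) =
      ∑ k ∈ Finset.range (l + 1),
        ((-1) ^ k * (l.choose k : ℤ) * ((2 * l - k).choose l : ℤ)) •
          ((a + b) ^ k * a ^ (l - k)) := by
  have neg_pow_zsmul (c : R) (n : ℕ) : (-c) ^ n = ((-1 : ℤ) ^ n) • c ^ n := by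
    rw [neg_pow, zsmul_eq_mul]
    push_cast
    rfl
  have key := h.sum_choose_sq_smul_pow_mul_neg_pow l
  simp only [neg_pow_zsmul, mul_smul_comm, smul_mul_assoc, ← natCast_zsmul, smul_smul] at key
  push_cast at key
  convert key using 3
  ring

theorem pd1_eq_fderiv {F : ℝ × ℝ → ℝ} (hF : Differentiable ℝ F) :
    pd1 F = fun p => fderiv ℝ F p (1, 0) := by
  funext p
  exact ((hF p).hasFDerivAt.comp_hasDerivAt p.1
    ((hasDerivAt_id p.1).prodMk (hasDerivAt_const p.1 p.2))).deriv

theorem pd2_eq_fderiv {F : ℝ × ℝ → ℝ} (hF : Differentiable ℝ F) :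
    pd2 F = fun p => fderiv ℝ F p (0, 1) := by
  funext p
  exact ((hF p).hasFDerivAt.comp_hasDerivAt p.2
    ((hasDerivAt_const p.2 p.1).prodMk (hasDerivAt_id p.2))).deriv

theorem deriv_diagonal {F : ℝ × ℝ → ℝ} (hF : Differentiable ℝ F) :
    deriv (fun w => F (w, w)) = fun w => pd1 F (w, w) + pd2 F (w, w) := by
  funext w
  rw [pd1_eq_fderiv hF, pd2_eq_fderiv hF]
  have h := (HasFDerivAt.comp_hasDerivAt (f := fun w : ℝ => (w, w)) w (hF (w, w)).hasFDerivAt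
    ((hasDerivAt_id w).prodMk (hasDerivAt_id w))).deriv
  simpa [Function.comp_def, ← map_add] using h

/-- The space of smooth real functions of two real variables. -/
def smoothFunctions : Submodule ℝ (ℝ × ℝ → ℝ) where
  carrier := {F | ContDiff ℝ ∞ F}
  add_mem' {F G} (hF : ContDiff ℝ ∞ F) (hG : ContDiff ℝ ∞ G) := hF.add hG
  zero_mem' := (contDiff_const : ContDiff ℝ ∞ fun _ : ℝ × ℝ => (0 : ℝ))
  smul_mem' c F (hF : ContDiff ℝ ∞ F) := hF.const_smul c

namespace smoothFunctions

theorem contDiff (F : smoothFunctions) : ContDiff ℝ ∞ F.1 := F.2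

theorem differentiable (F : smoothFunctions) : Differentiable ℝ F.1 :=
  (contDiff F).differentiable (by simp)

/-- The directional derivative as an endomorphism of the space of smooth functions. -/
def dirDeriv (v : ℝ × ℝ) : Module.End ℝ smoothFunctions where
  toFun F := ⟨fun p => fderiv ℝ F.1 p v,
    ((contDiff F).fderiv_right (m := ∞) (by simp)).clm_apply contDiff_const⟩
  map_add' F G := by
    ext p
    simp [fderiv_add ((differentiable F) p) ((differentiable G) p)]
  map_smul' c F := by
    ext p
    simp [fderiv_const_smul ((differentiable F) p)]

theorem coe_dirDeriv_fst (F : smoothFunctions) : (dirDeriv (1, 0) F).1 = pd1 F.1 :=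
  (pd1_eq_fderiv (differentiable F)).symm

theorem coe_dirDeriv_snd (F : smoothFunctions) : (dirDeriv (0, 1) F).1 = pd2 F.1 :=
  (pd2_eq_fderiv (differentiable F)).symm

theorem coe_dirDeriv_fst_pow (n : ℕ) (F : smoothFunctions) :
    ((dirDeriv (1, 0) ^ n) F).1 = pd1^[n] F.1 := by
  rw [Module.End.pow_apply]
  exact Function.Semiconj.iterate_right coe_dirDeriv_fst n F

theorem coe_dirDeriv_snd_pow (n : ℕ) (F : smoothFunctions) :
    ((dirDeriv (0, 1) ^ n) F).1 = pd2^[n] F.1 := by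
  rw [Module.End.pow_apply]
  exact Function.Semiconj.iterate_right coe_dirDeriv_snd n F

theorem commute_dirDeriv (v w : ℝ × ℝ) : Commute (dirDeriv v) (dirDeriv w) := by
  ext F p
  have hd : DifferentiableAt ℝ (fderiv ℝ F.1) p :=
    ((contDiff F).fderiv_right (m := ∞) (by simp)).differentiable (by simp) p
  have hsymm : IsSymmSndFDerivAt ℝ F.1 p :=
    (contDiff F).contDiffAt.isSymmSndFDerivAt (by
      simpa using WithTop.coe_le_coe.mpr (le_top : (2 : ℕ∞) ≤ ⊤))
  have key (v w : ℝ × ℝ) :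
      fderiv ℝ (fun q => fderiv ℝ F.1 q w) p v = fderiv ℝ (fderiv ℝ F.1) p v w := by
    rw [fderiv_clm_apply hd (differentiableAt_const w)]
    simp
  exact (key v w).trans ((hsymm.eq v w).trans (key w v).symm)

theorem iterate_deriv_diagonal (n : ℕ) (F : smoothFunctions) :
    deriv^[n] (fun w => F.1 (w, w)) =
      fun w => (((dirDeriv (1, 0) + dirDeriv (0, 1)) ^ n) F).1 (w, w) := by
  rw [Module.End.pow_apply]
  refine (Function.Semiconj.iterate_right (f := fun (F : smoothFunctions) w => F.1 (w, w))
    (fun F => ?_) n F).symm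
  change _ = deriv (fun w => F.1 (w, w))
  rw [deriv_diagonal (differentiable F), ← coe_dirDeriv_fst, ← coe_dirDeriv_snd]
  rfl

end smoothFunctions

/-- Lemma 1.3, formula (1.32): the quasiprimary combination
Σ_{k=0}^{l} C(l,k)² (∂₁^k(−∂₂)^{l−k}F)(z,z) equals
Σ_{k=0}^{l} (−1)^k C(l,k) C(2l−k,l) (d/dz)^k [J^{l−k}[F]](z), where
J^m[F](z) = (∂₁^m F)(z,z). -/
theorem quasiprimary_in_terms_of_taylor_fields (F : ℝ × ℝ → ℝ)
    (hF : ContDiff ℝ (⊤ : ℕ∞) F) (l : ℕ) (z : ℝ) :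
    ∑ k ∈ Finset.range (l + 1),
        (Nat.choose l k : ℝ) ^ 2 * (-1 : ℝ) ^ (l - k) *
          (pd1^[k] (pd2^[l - k] F)) (z, z) =
      ∑ k ∈ Finset.range (l + 1),
        (-1 : ℝ) ^ k * (Nat.choose l k : ℝ) * (Nat.choose (2 * l - k) l : ℝ) *
          deriv^[k] (fun w => (pd1^[l - k] F) (w, w)) z := by
  let A := smoothFunctions.dirDeriv (1, 0)
  let B := smoothFunctions.dirDeriv (0, 1)
  let f : smoothFunctions := ⟨F, hF⟩
  let ev : Module.End ℝ smoothFunctions →+ ℝ :=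
    { toFun := fun T => (T f).1 (z, z)
      map_zero' := rfl
      map_add' := fun _ _ => rfl }
  have h := congrArg ev ((smoothFunctions.commute_dirDeriv (1, 0)
    (0, 1)).sum_neg_one_pow_choose_sq_smul_pow_mul_pow l)
  have left (k : ℕ) : ev (A ^ k * B ^ (l - k)) = (pd1^[k] (pd2^[l - k] F)) (z, z) := by
    change ((A ^ k) ((B ^ (l - k)) f)).1 (z, z) = _
    rw [smoothFunctions.coe_dirDeriv_fst_pow, smoothFunctions.coe_dirDeriv_snd_pow]
  have right (k : ℕ) : ev ((A + B) ^ k * A ^ (l - k)) =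
      deriv^[k] (fun w => (pd1^[l - k] F) (w, w)) z := by
    have := congrFun (smoothFunctions.iterate_deriv_diagonal k ((A ^ (l - k)) f)) z
    rw [smoothFunctions.coe_dirDeriv_fst_pow] at this
    exact this.symm
  simp only [map_sum, map_zsmul, A, B] at h left right
  simp only [left, right, zsmul_eq_mul] at h
  push_cast at h
  exact h
end
end

section
/- Let l be a natural number, n ∈ ℤ, and p ∈ ℂ[X] a polynomial of degree ≤ l. Define matrices A, Λ_m : ℤ × ℤ → ℂ by A(i,j) = p(j) if i = j + n and A(i,j) = 0 otherwise, and Λ_m(i,j) = 1 if i = j + m and 0 otherwise (m ∈ ℤ). Then for all m₀, m₁, …, m_l ∈ ℤ the (l+1)-fold iterated commutator ad Λ_{m₀}(ad Λ_{m₁}(⋯ ad Λ_{m_l}(A) ⋯)) is the zero matrix, where ad X(Y) = XY − YX. (The matrix-part statement of Proposition 2.1: the (l+1)-fold commutator of current modes with a mode of V^l has vanishing noncentral part; each commutator with a shift matrix lowers the polynomial degree of the diagonal entries by one.) -/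
open scoped BigOperators

noncomputable section

/-- Matrix product of two infinite matrices (entrywise a finite sum for
single-diagonal matrices). -/
def mmul (X Y : ℤ × ℤ → ℂ) : ℤ × ℤ → ℂ :=
  fun p => ∑ᶠ j : ℤ, X (p.1, j) * Y (j, p.2)

/-- Adjoint action ad X(Y) = XY − YX. -/
def adM (X Y : ℤ × ℤ → ℂ) : ℤ × ℤ → ℂ :=
  fun p => mmul X Y p - mmul Y X p

/-- The shift matrix Λ_m with Λ_m(i,j) = 1 if i = j + m and 0 otherwise. -/
def Lam (m : ℤ) : ℤ × ℤ → ℂ := fun p => if p.1 = p.2 + m then 1 else 0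

/-- The matrix with entries p(j) on the diagonal i = j + n and zero elsewhere. -/
def polyDiag (n : ℤ) (p : Polynomial ℂ) : ℤ × ℤ → ℂ :=
  fun q => if q.1 = q.2 + n then p.eval (q.2 : ℂ) else 0

theorem mmul_Lam_left (m : ℤ) (Y : ℤ × ℤ → ℂ) (q : ℤ × ℤ) :
    mmul (Lam m) Y q = Y (q.1 - m, q.2) := by
  unfold mmul Lam
  rw [finsum_eq_single _ (q.1 - m)]
  · simp
  · intro j hj
    have : q.1 ≠ j + m := by omega
    simp [this]

theorem mmul_Lam_right (m : ℤ) (X : ℤ × ℤ → ℂ) (q : ℤ × ℤ) :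
    mmul X (Lam m) q = X (q.1, q.2 + m) := by
  unfold mmul Lam
  rw [finsum_eq_single _ (q.2 + m)]
  · simp
  · intro j hj
    simp [hj]

/-- The commutator with a shift replaces the polynomial p by p(x) − p(x + m). -/
theorem adM_Lam_polyDiag (m n : ℤ) (p : Polynomial ℂ) :
    adM (Lam m) (polyDiag n p) = polyDiag (n + m) (p - Polynomial.taylor (m : ℂ) p) := by
  funext q
  simp only [adM, mmul_Lam_left, mmul_Lam_right, polyDiag, Polynomial.eval_sub,
    Polynomial.taylor_eval]
  by_cases h : q.1 = q.2 + (n + m)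
  · have h₁ : q.1 - m = q.2 + n := by omega
    have h₂ : q.1 = q.2 + m + n := by omega
    rw [if_pos h, if_pos h₁, if_pos h₂]
    rw [Int.cast_add]
  · have h₁ : ¬ q.1 - m = q.2 + n := by omega
    have h₂ : ¬ q.1 = q.2 + m + n := by omega
    rw [if_neg h, if_neg h₁, if_neg h₂, sub_zero]

theorem degree_sub_taylor_lt {R : Type*} [CommRing R] (c : R) {p : Polynomial R} {d : ℕ}
    (hp : p.degree < ((d + 1 : ℕ) : WithBot ℕ)) :
    (p - Polynomial.taylor c p).degree < (d : WithBot ℕ) := by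
  rcases eq_or_ne p 0 with rfl | h0
  · simp
  · refine (Polynomial.degree_sub_lt_left (Polynomial.degree_taylor p c).symm h0
      (Polynomial.leadingCoeff_taylor c p).symm).trans_le ?_
    rw [Polynomial.degree_eq_natDegree h0] at hp ⊢
    exact_mod_cast Nat.lt_succ_iff.mp (by exact_mod_cast hp)

theorem exists_foldr_adM_eq_polyDiag (n : ℤ) (p : Polynomial ℂ) (L : List ℤ) (d : ℕ)
    (hp : p.degree < ((d + L.length : ℕ) : WithBot ℕ)) :
    ∃ (k : ℤ) (r : Polynomial ℂ), r.degree < (d : WithBot ℕ) ∧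
      L.foldr (fun mi B => adM (Lam mi) B) (polyDiag n p) = polyDiag k r := by
  induction L generalizing d with
  | nil => exact ⟨n, p, by simpa using hp, rfl⟩
  | cons a L ih =>
    obtain ⟨k, r, hr, h⟩ := ih (d + 1) (by
      rwa [List.length_cons, add_comm L.length, ← add_assoc] at hp)
    exact ⟨k + a, _, degree_sub_taylor_lt (a : ℂ) hr, by
      rw [List.foldr_cons, h, adM_Lam_polyDiag]⟩

/-- The matrix-part statement of Proposition 2.1: if A(i,j) = p(j) on the
diagonal i = j + n (with p a polynomial of degree ≤ l) and zero elsewhere,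
then the (l+1)-fold iterated commutator
ad Λ_{m₀}(ad Λ_{m₁}(⋯ ad Λ_{m_l}(A)⋯)) vanishes. -/
theorem iterated_commutator_with_shifts_vanishes (l : ℕ) (n : ℤ)
    (p : Polynomial ℂ) (hp : p.degree ≤ (l : WithBot ℕ))
    (m : Fin (l + 1) → ℤ) :
    (List.ofFn m).foldr (fun mi B => adM (Lam mi) B)
        (fun q : ℤ × ℤ => if q.1 = q.2 + n then p.eval (q.2 : ℂ) else 0) =
      0 := by
  obtain ⟨k, r, hr, h⟩ := exists_foldr_adM_eq_polyDiag n p (List.ofFn m) 0 (by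
    rw [List.length_ofFn, zero_add]
    exact hp.trans_lt (by exact_mod_cast Nat.lt_succ_self l))
  have hr0 : r = 0 := by
    by_contra h0
    exact absurd (Polynomial.zero_le_degree_iff.mpr h0) (not_le.mpr hr)
  refine h.trans ?_
  funext q
  simp [polyDiag, hr0]
end
end

section
/- For a natural number l define the polynomial function v_l : ℝ → ℝ by v₀(r) = r and, for l ≥ 1, v_l(r) = ((l−1)!·l!/(2l)!) · Σ_{k=0}^{l−1} C(l,k)·C(l,k+1) · r · Π_{i=0}^{l−1} (r − k + i). Then for every natural number c, every tuple r = (r₁,…,r_c) of real numbers, and every natural number n: Σ_{i=1}^{c} ( r_i(r_i+1)⋯(r_i+n) / (n+1)! ) = Σ_{l=0}^{n} C(n,l) · ( n!·(2l+1)! / ((l!)²·(l+n+1)!) ) · V_l(r), where V_l(r) = Σ_{i=1}^{c} v_l(r_i). (The recurrence relation (2.10a) determining the eigenvalues V_l(r⃗) of the zero modes V^l₀ on the lowest weight vector |r⃗⟩, with solution (2.10b).) -/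
noncomputable section

/-- The polynomial function v_l : v₀(r) = r and, for l ≥ 1,
v_l(r) = ((l−1)!·l!/(2l)!) Σ_{k=0}^{l−1} C(l,k) C(l,k+1) r Π_{i=0}^{l−1}(r−k+i). -/
def vl : ℕ → ℝ → ℝ
  | 0, r => r
  | (m + 1), r =>
      ((Nat.factorial m : ℝ) * (Nat.factorial (m + 1) : ℝ) /
          (Nat.factorial (2 * (m + 1)) : ℝ)) *
        ∑ k ∈ Finset.range (m + 1),
          (Nat.choose (m + 1) k : ℝ) * (Nat.choose (m + 1) (k + 1) : ℝ) * r *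
            ∏ i ∈ Finset.range (m + 1), (r - (k : ℝ) + (i : ℝ))

open Finset

/-- The product `C(l,k) C(l,k+1) (r-k)(r-k+1)⋯(r-k+l-1)`. -/
def vlSummand (r : ℝ) (l k : ℕ) : ℝ :=
  (l.choose k : ℝ) * (l.choose (k + 1) : ℝ) * ∏ i ∈ range l, (r - k + i)

/-- The sum defining `vl`, without its prefactor and without the factor `r`. -/
def vlSum (r : ℝ) (l : ℕ) : ℝ := ∑ k ∈ range l, vlSummand r l k

theorem succ_mul_choose_succ_real (n k : ℕ) :
    ((k : ℝ) + 1) * (n.choose (k + 1) : ℝ) = ((n : ℝ) - k) * (n.choose k : ℝ) := by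
  rcases le_or_gt k n with h | h
  · have := Nat.choose_succ_right_eq n k
    rw [← Nat.cast_sub h]
    exact_mod_cast (by linarith : (k + 1) * n.choose (k + 1) = (n - k) * n.choose k)
  · simp [Nat.choose_eq_zero_of_lt h, Nat.choose_eq_zero_of_lt (Nat.lt_succ_of_lt h)]

theorem succ_mul_choose_real (n k : ℕ) :
    ((n : ℝ) + 1) * (n.choose k : ℝ) = ((n + 1).choose (k + 1) : ℝ) * (k + 1) := by
  exact_mod_cast Nat.add_one_mul_choose_eq n k

theorem succ_mul_choose_succ_right_real (n k : ℕ) :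
    ((n : ℝ) + 1) * (n.choose (k + 1) : ℝ) = ((n + 1).choose (k + 1) : ℝ) * (n - k) := by
  have h := succ_mul_choose_real n k
  have h' : ((n + 1).choose (k + 1) : ℝ) = n.choose k + n.choose (k + 1) := by
    exact_mod_cast Nat.choose_succ_succ n k
  linear_combination ((n : ℝ) + 1) * (-h') - h

theorem prod_shift_sub_one (x : ℝ) (l : ℕ) :
    ∏ i ∈ range (l + 1), (x - 1 + (i : ℝ)) = (x - 1) * ∏ i ∈ range l, (x + (i : ℝ)) := by
  rw [prod_range_succ', mul_comm]
  congr 1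
  · simp
  · refine prod_congr rfl fun i _ => ?_
    push_cast
    ring

/-- A telescoped form of the three-term recurrence for `vlSum`. -/
theorem sum_vlSummand_telescope (r : ℝ) (l K : ℕ) :
    ∑ k ∈ range K, (((l : ℝ) + 1) * (l + 2) * (l + 3) * vlSummand r (l + 2) k -
        2 * (2 * l + 3) * (l + 2) ^ 2 * r * vlSummand r (l + 1) k -
        (l + 1) ^ 3 * (l + 2) ^ 2 * vlSummand r l k) =
      ((l + 2).choose K : ℝ) * ((l + 2).choose (K + 1) : ℝ) * K * (K + 1) *
        (-(l + 1) * (2 * l + 3) - (3 * l + 5) * r + (3 * l + 4) * K + 2 * K * r - K ^ 2) *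
        ∏ i ∈ range (l + 1), (r - K + i) := by
  induction K with
  | zero => simp
  | succ k ih =>
    rw [sum_range_succ, ih]
    have hP : ∏ i ∈ range (l + 1), (r - ((k + 1 : ℕ) : ℝ) + (i : ℝ)) =
        (r - k - 1) * ∏ i ∈ range l, (r - k + (i : ℝ)) := by
      rw [← prod_shift_sub_one]
      refine prod_congr rfl fun i _ => ?_
      push_cast
      ring
    rw [hP]
    simp only [vlSummand, prod_range_succ]
    generalize ∏ i ∈ range l, (r - k + (i : ℝ)) = P
    have h1 := succ_mul_choose_real (l + 1) k
    have h2 := succ_mul_choose_succ_right_real (l + 1) k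
    have h3 := succ_mul_choose_real l k
    have h4 := succ_mul_choose_succ_right_real l k
    have h5 := succ_mul_choose_succ_real (l + 2) k
    have h6 := succ_mul_choose_succ_real (l + 2) (k + 1)
    simp only [show l + 1 + 1 = l + 2 from rfl, show k + 1 + 1 = k + 2 from rfl] at *
    push_cast at *
    have hl1 : (l : ℝ) + 1 ≠ 0 := by positivity
    have hl2 : (l : ℝ) + 2 ≠ 0 := by positivity
    have hk2 : (k : ℝ) + 2 ≠ 0 := by positivity
    generalize ((l + 2).choose k : ℝ) = d at *
    generalize ((l + 2).choose (k + 1) : ℝ) = e at *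
    generalize ((l + 2).choose (k + 2) : ℝ) = f at *
    generalize ((l + 1).choose k : ℝ) = a1 at *
    generalize ((l + 1).choose (k + 1) : ℝ) = a2 at *
    generalize (l.choose k : ℝ) = b1 at *
    generalize (l.choose (k + 1) : ℝ) = b2 at *
    generalize (l : ℝ) = l at *
    generalize (k : ℝ) = k at *
    obtain rfl : a1 = e * (k + 1) / (l + 2) := by
      rw [eq_div_iff hl2]; linear_combination h1
    obtain rfl : a2 = e * (l + 1 - k) / (l + 2) := by
      rw [eq_div_iff hl2]; linear_combination h2
    obtain rfl : b1 = e * (l + 1 - k) / (l + 2) * (k + 1) / (l + 1) := by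
      rw [eq_div_iff hl1]; linear_combination h3
    obtain rfl : b2 = e * (l + 1 - k) / (l + 2) * (l - k) / (l + 1) := by
      rw [eq_div_iff hl1]; linear_combination h4
    obtain rfl : f = (l + 1 - k) * e / (k + 2) := by
      rw [eq_div_iff hk2]; linear_combination h6
    clear h1 h2 h3 h4 h6
    field_simp
    linear_combination e * P * (k + 2) * (l + 1 - k) *
      (-(2 * (2 * l + 3) * r * (r - k + l)) - (l + 1) * (l + 1 - k) * (l - k) -
        (-(l + 1) * (2 * l + 3) - (3 * l + 5) * r + (3 * l + 4) * (k + 1) + 2 * (k + 1) * r -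
          (k + 1) ^ 2) * (r - k - 1)) * h5

theorem vlSum_recurrence (r : ℝ) (l : ℕ) :
    ((l : ℝ) + 1) * (l + 3) * vlSum r (l + 2) =
      2 * (2 * l + 3) * (l + 2) * r * vlSum r (l + 1) + (l + 1) ^ 3 * (l + 2) * vlSum r l := by
  have h := sum_vlSummand_telescope r l (l + 2)
  have e1 : ∑ k ∈ range (l + 2), vlSummand r (l + 1) k = vlSum r (l + 1) := by
    rw [sum_range_succ, vlSum]; simp [vlSummand]
  have e2 : ∑ k ∈ range (l + 2), vlSummand r l k = vlSum r l := by
    rw [sum_range_succ, sum_range_succ, vlSum]; simp [vlSummand]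
  rw [Nat.choose_succ_self (l + 2), sum_sub_distrib, sum_sub_distrib, ← mul_sum, ← mul_sum,
    ← mul_sum, e1, e2, ← vlSum] at h
  have hl2 : (l : ℝ) + 2 ≠ 0 := by positivity
  apply mul_left_cancel₀ hl2
  push_cast at h
  linear_combination h

theorem vl_succ (m : ℕ) (r : ℝ) :
    vl (m + 1) r = (m.factorial : ℝ) * ((m + 1).factorial : ℝ) /
      ((2 * (m + 1)).factorial : ℝ) * (r * vlSum r (m + 1)) := by
  rw [vl, vlSum, mul_sum _ _ r]
  congr 1
  refine sum_congr rfl fun k _ => ?_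
  rw [vlSummand]
  ring

/-- The three-term recurrence for `vl`. -/
theorem mul_vl_succ (m : ℕ) (r : ℝ) :
    r * vl (m + 1) r = ((m : ℝ) + 3) / (m + 2) * vl (m + 2) r -
      ((m : ℝ) + 1) ^ 3 * m / (4 * (2 * m + 1) * (2 * m + 3)) * vl m r := by
  have h := vlSum_recurrence r m
  cases m with
  | zero =>
    rw [vl_succ, vl_succ]
    norm_num [Nat.factorial, vlSum] at h ⊢
    linear_combination (-r / 24) * h
  | succ m =>
    rw [vl_succ, vl_succ, vl_succ]
    have f1 : ((2 * (m + 1 + 1)).factorial : ℝ) =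
        (2 * m + 4) * (2 * m + 3) * (2 * (m + 1)).factorial := by
      rw [show 2 * (m + 1 + 1) = 2 * (m + 1) + 1 + 1 by ring, Nat.factorial_succ,
        Nat.factorial_succ]
      push_cast
      ring
    have f2 : ((2 * (m + 2 + 1)).factorial : ℝ) =
        (2 * m + 6) * (2 * m + 5) * ((2 * m + 4) * (2 * m + 3) * (2 * (m + 1)).factorial) := by
      rw [← f1, show 2 * (m + 2 + 1) = 2 * (m + 1 + 1) + 1 + 1 by ring, Nat.factorial_succ,
        Nat.factorial_succ]
      push_cast
      ring
    have f3 : ((2 * (m + 1)).factorial : ℝ) ≠ 0 := by positivity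
    have f4 : (m.factorial : ℝ) ≠ 0 := by positivity
    rw [show m + 1 + 2 = m + 2 + 1 from rfl] at *
    rw [f2, f1]
    simp only [Nat.factorial_succ]
    push_cast at *
    generalize vlSum r (m + 2 + 1) = x at *
    generalize vlSum r (m + 1 + 1) = y at *
    generalize vlSum r (m + 1) = z at *
    generalize ((2 * (m + 1)).factorial : ℝ) = F at *
    field_simp
    linear_combination -2 * r * (2 * m + 6) * (2 * m + 5) * (2 * m + 3) * h

/-- The coefficient of `vl l` in the expansion of `r(r+1)⋯(r+n)/(n+1)!`. -/
def vlCoeff (n l : ℕ) : ℝ :=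
  (Nat.choose n l : ℝ) *
    ((Nat.factorial n : ℝ) * (Nat.factorial (2 * l + 1) : ℝ) /
      ((Nat.factorial l : ℝ) ^ 2 * (Nat.factorial (l + n + 1) : ℝ)))

theorem vlCoeff_eq_zero {n l : ℕ} (h : n < l) : vlCoeff n l = 0 := by
  simp [vlCoeff, Nat.choose_eq_zero_of_lt h]

theorem vlCoeff_zero (n : ℕ) : vlCoeff n 0 = 1 / (n + 1) := by
  have : (n.factorial : ℝ) ≠ 0 := by positivity
  simp only [vlCoeff, zero_add, Nat.factorial_succ]
  push_cast
  field_simp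
  simp

theorem vlCoeff_recurrence (n m : ℕ) :
    ((n : ℝ) + 2) * vlCoeff (n + 1) (m + 1) = ((m : ℝ) + 2) / (m + 1) * vlCoeff n m -
      ((m : ℝ) + 2) ^ 3 * (m + 1) / (4 * (2 * m + 3) * (2 * m + 5)) * vlCoeff n (m + 2) +
      (n + 1) * vlCoeff n (m + 1) := by
  have hm1 : (m : ℝ) + 1 ≠ 0 := by positivity
  have hm2 : (m : ℝ) + 2 ≠ 0 := by positivity
  have c1 : (n.choose (m + 1) : ℝ) = (n - m) * n.choose m / (m + 1) := by
    rw [eq_div_iff hm1, ← succ_mul_choose_succ_real]; ring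
  have c2 : (n.choose (m + 2) : ℝ) = (n - m - 1) * ((n - m) * n.choose m / (m + 1)) / (m + 2) := by
    have := succ_mul_choose_succ_real n (m + 1)
    push_cast at this
    rw [eq_div_iff hm2, ← c1]; linear_combination this
  have c3 : ((n + 1).choose (m + 1) : ℝ) = (n + 1) * n.choose m / (m + 1) := by
    rw [eq_div_iff hm1, ← succ_mul_choose_real]
  have g1 : (m.factorial : ℝ) ≠ 0 := by positivity
  have g2 : (n.factorial : ℝ) ≠ 0 := by positivity
  have g3 : ((2 * m + 1).factorial : ℝ) ≠ 0 := by positivity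
  have g4 : ((m + n + 1).factorial : ℝ) ≠ 0 := by positivity
  simp only [vlCoeff, c1, c2, c3]
  rw [show 2 * (m + 1) + 1 = 2 * m + 1 + 1 + 1 by ring,
    show 2 * (m + 2) + 1 = 2 * m + 1 + 1 + 1 + 1 + 1 by ring,
    show m + 1 + (n + 1) + 1 = m + n + 1 + 1 + 1 by ring,
    show m + 1 + n + 1 = m + n + 1 + 1 by ring,
    show m + 2 + n + 1 = m + n + 1 + 1 + 1 by ring]
  simp only [Nat.factorial_succ] at *
  push_cast at *
  field_simp
  ring

theorem sum_vlCoeff_telescope (r : ℝ) (n m : ℕ) :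
    ∑ l ∈ range (m + 1), (((n : ℝ) + 2) * vlCoeff (n + 1) l * vl l r -
        (r + n + 1) * (vlCoeff n l * vl l r)) =
      -((m : ℝ) + 1) ^ 3 * m / (4 * (2 * m + 1) * (2 * m + 3)) * vlCoeff n (m + 1) * vl m r -
        ((m : ℝ) + 2) / (m + 1) * vlCoeff n m * vl (m + 1) r := by
  induction m with
  | zero =>
    rw [vl_succ]
    have : (n : ℝ) + 1 ≠ 0 := by positivity
    have : (n : ℝ) + 2 ≠ 0 := by positivity
    simp [vlCoeff_zero, vl, vlSum, vlSummand]
    field_simp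
    ring
  | succ m ih =>
    rw [sum_range_succ, ih]
    have h1 := vlCoeff_recurrence n m
    have h2 := mul_vl_succ m r
    push_cast
    linear_combination vl (m + 1) r * h1 - vlCoeff n (m + 1) * h2

/-- The expansion of a rising factorial in the `vl`. -/
theorem prod_div_factorial_eq_sum_vlCoeff (r : ℝ) (n : ℕ) :
    (∏ j ∈ range (n + 1), (r + (j : ℝ))) / (Nat.factorial (n + 1) : ℝ) =
      ∑ l ∈ range (n + 1), vlCoeff n l * vl l r := by
  induction n with
  | zero => simp [vlCoeff, vl]
  | succ n ih =>
    have h := sum_vlCoeff_telescope r n (n + 1)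
    rw [vlCoeff_eq_zero (by omega), vlCoeff_eq_zero (by omega), sum_sub_distrib, ← mul_sum,
      sum_range_succ (fun l => vlCoeff n l * vl l r), vlCoeff_eq_zero (Nat.lt_succ_self n),
      zero_mul, add_zero, ← ih] at h
    simp only [mul_assoc] at h
    rw [← mul_sum] at h
    have hn : (n : ℝ) + 2 ≠ 0 := by positivity
    have hf : ((n + 1).factorial : ℝ) ≠ 0 := by positivity
    apply mul_left_cancel₀ hn
    rw [prod_range_succ, Nat.factorial_succ (n + 1)]
    push_cast
    have e : ((n : ℝ) + 2) * ((∏ j ∈ range (n + 1), (r + (j : ℝ))) * (r + (n + 1)) /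
        ((n + 1 + 1) * ((n + 1).factorial : ℝ))) =
        (r + n + 1) * ((∏ j ∈ range (n + 1), (r + (j : ℝ))) / ((n + 1).factorial : ℝ)) := by
      have : (n : ℝ) + 1 + 1 ≠ 0 := by positivity
      field_simp
      ring
    rw [e]
    linear_combination -h

/-- The recurrence relation (2.10a) determining the zero-mode eigenvalues
V_l(r⃗), with solution (2.10b):
Σ_i r_i(r_i+1)⋯(r_i+n)/(n+1)! =
  Σ_{l=0}^{n} C(n,l) (n!(2l+1)!/((l!)²(l+n+1)!)) V_l(r⃗),
where V_l(r⃗) = Σ_i v_l(r_i). -/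
theorem zero_mode_eigenvalues_recurrence (c : ℕ) (r : Fin c → ℝ) (n : ℕ) :
    ∑ i, (∏ j ∈ Finset.range (n + 1), (r i + (j : ℝ))) /
        (Nat.factorial (n + 1) : ℝ) =
      ∑ l ∈ Finset.range (n + 1),
        (Nat.choose n l : ℝ) *
          ((Nat.factorial n : ℝ) * (Nat.factorial (2 * l + 1) : ℝ) /
            ((Nat.factorial l : ℝ) ^ 2 * (Nat.factorial (l + n + 1) : ℝ))) *
          ∑ i, vl l (r i) := by
  simp only [prod_div_factorial_eq_sum_vlCoeff, mul_sum]
  rw [sum_comm]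
  rfl
end
end

section
/- For a natural number l define the polynomial function v_l : ℝ → ℝ by v₀(r) = r and, for l ≥ 1, v_l(r) = ((l−1)!·l!/(2l)!) · Σ_{k=0}^{l−1} C(l,k)·C(l,k+1) · r · Π_{i=0}^{l−1} (r − k + i). Then for every l ≥ 1, every natural number c, and every tuple r = (r₁,…,r_c) of real numbers: V_l(−r) = (−1)^{l+1} V_l(r), where V_l(r) = Σ_{i=1}^{c} v_l(r_i) and −r = (−r₁,…,−r_c). (The parity property of the zero-mode eigenvalues stated in (2.11).) -/
noncomputable section

/-- Reflecting `k ↦ m - k` and `i ↦ m - i` turns the rising product at `-r` into the one at `r`. -/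
theorem prod_range_neg_reflect (m k : ℕ) (hk : k ≤ m) (r : ℝ) :
    ∏ i ∈ Finset.range (m + 1), (-r - ((m - k : ℕ) : ℝ) + (i : ℝ)) =
      (-1) ^ (m + 1) * ∏ i ∈ Finset.range (m + 1), (r - (k : ℝ) + (i : ℝ)) := by
  rw [← Finset.prod_range_reflect, ← Finset.card_range (m + 1), ← Finset.prod_const,
    Finset.card_range, ← Finset.prod_mul_distrib]
  refine Finset.prod_congr rfl fun i hi => ?_
  have him : i ≤ m := Nat.lt_succ_iff.mp (Finset.mem_range.mp hi)
  rw [Nat.add_sub_cancel, Nat.cast_sub hk, Nat.cast_sub him]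
  ring

theorem vl_succ_neg (m : ℕ) (r : ℝ) : vl (m + 1) (-r) = (-1) ^ (m + 2) * vl (m + 1) r := by
  simp only [vl]
  rw [mul_left_comm, ← Finset.sum_range_reflect, Finset.mul_sum _ _ ((-1 : ℝ) ^ (m + 2))]
  congr 1
  refine Finset.sum_congr rfl fun k hk => ?_
  have hkm : k ≤ m := Nat.lt_succ_iff.mp (Finset.mem_range.mp hk)
  have h₁ : (m + 1).choose (m - k) = (m + 1).choose (k + 1) :=
    Nat.choose_symm_of_eq_add (by omega)
  have h₂ : (m + 1).choose (m - k + 1) = (m + 1).choose k :=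
    Nat.choose_symm_of_eq_add (by omega)
  rw [Nat.add_sub_cancel, h₁, h₂, prod_range_neg_reflect m k hkm]
  ring

/-- The parity property (2.11) of the zero-mode eigenvalues:
V_l(−r⃗) = (−1)^{l+1} V_l(r⃗) for l ≥ 1, where V_l(r⃗) = Σ_i v_l(r_i). -/
theorem zero_mode_eigenvalues_parity (l : ℕ) (hl : 1 ≤ l) (c : ℕ)
    (r : Fin c → ℝ) :
    ∑ i, vl l (-(r i)) = (-1 : ℝ) ^ (l + 1) * ∑ i, vl l (r i) := by
  obtain ⟨m, rfl⟩ := Nat.exists_eq_add_of_le' hl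
  rw [Finset.mul_sum]
  exact Finset.sum_congr rfl fun i _ => vl_succ_neg m (r i)
end
end

section
/- For every natural number l and all real numbers z₁, z₂, w with w ≠ z₁ and w ≠ z₂, one has ∂₃^l(−∂₄)^l [ (z₃−z₄)^l / ((z₁−z₄)(z₂−z₃)) ] evaluated at z₃ = z₄ = w equal to (l!)² · (z₁−z₂)^l / ((z₁−w)(z₂−w))^{l+1}. Equivalently, applying the normalized extraction (l!/(2l)!)·∂₃^l(−∂₄)^l[(z₃−z₄)^l · — ] at coincident points to the 4-point function c/((z₁−z₄)(z₂−z₃)) of the bilocal field yields the 3-point function l!·C(2l,l)^{−1}·c·(z₁−z₂)^l/((z₁−w)(z₂−w))^{l+1} of formula (1.19). -/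
noncomputable section

theorem pd1_iterate (n : ℕ) (F : ℝ × ℝ → ℝ) (p : ℝ × ℝ) :
    pd1^[n] F p = iteratedDeriv n (fun x => F (x, p.2)) p.1 := by
  induction n generalizing p with
  | zero => simp
  | succ n ih =>
    rw [Function.iterate_succ_apply', iteratedDeriv_succ, pd1]
    simp only [ih]

theorem pd2_iterate (n : ℕ) (F : ℝ × ℝ → ℝ) (p : ℝ × ℝ) :
    pd2^[n] F p = iteratedDeriv n (fun y => F (p.1, y)) p.2 := by
  induction n generalizing p with
  | zero => simp
  | succ n ih =>
    rw [Function.iterate_succ_apply', iteratedDeriv_succ, pd2]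
    simp only [ih]

theorem iteratedDeriv_succ_sub_pow (n : ℕ) (a y : ℝ) :
    iteratedDeriv (n + 1) (fun t => (t - a) ^ n) y = 0 := by
  rw [iteratedDeriv_comp_sub_const (n + 1) (fun t : ℝ => t ^ n) a]
  simp [iteratedDeriv_pow]

theorem iteratedDeriv_sub_pow_div_sub (n : ℕ) (a b : ℝ) {y : ℝ} (hy : y ≠ b) :
    iteratedDeriv n (fun t => (t - a) ^ n / (b - t)) y =
      n.factorial * (b - a) ^ n / (b - y) ^ (n + 1) := by
  induction n generalizing y with
  | zero => simp
  | succ n ih =>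
    have hby : b - y ≠ 0 := sub_ne_zero.2 hy.symm
    have hne : ∀ᶠ t in nhds y, t ≠ b := isOpen_ne.mem_nhds hy
    have hsplit : (fun t => (t - a) ^ (n + 1) / (b - t)) =ᶠ[nhds y]
        fun t => (b - a) * ((t - a) ^ n / (b - t)) - (t - a) ^ n := by
      filter_upwards [hne] with t ht
      have : b - t ≠ 0 := sub_ne_zero.2 ht.symm
      field_simp
      ring
    have hclosed : iteratedDeriv n (fun t => (t - a) ^ n / (b - t)) =ᶠ[nhds y]
        fun t => n.factorial * (b - a) ^ n / (b - t) ^ (n + 1) := by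
      filter_upwards [hne] with t ht using ih ht
    have hderiv : HasDerivAt (fun t => n.factorial * (b - a) ^ n / (b - t) ^ (n + 1))
        ((n + 1) * n.factorial * (b - a) ^ n / (b - y) ^ (n + 2)) y := by
      refine ((hasDerivAt_const y (n.factorial * (b - a) ^ n)).fun_div
        (((hasDerivAt_id' y).const_sub b).fun_pow (n + 1)) (pow_ne_zero _ hby)).congr_deriv ?_
      push_cast
      field_simp
      ring
    have hf : ContDiffAt ℝ (n + 1 : ℕ) (fun t => (t - a) ^ n / (b - t)) y :=
      ContDiffAt.div (by fun_prop) (by fun_prop) hby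
    rw [hsplit.iteratedDeriv_eq, iteratedDeriv_fun_sub (contDiffAt_const.mul hf) (by fun_prop),
      iteratedDeriv_succ_sub_pow, iteratedDeriv_const_mul_field, iteratedDeriv_succ,
      hclosed.deriv_eq, hderiv.deriv, Nat.factorial_succ]
    push_cast
    ring

/-- Applying ∂₃^l(−∂₄)^l to (z₃,z₄) ↦ (z₃−z₄)^l/((z₁−z₄)(z₂−z₃)) and setting
z₃ = z₄ = w gives (l!)² (z₁−z₂)^l/((z₁−w)(z₂−w))^{l+1}: the extraction of the
3-point function (1.19) from the 4-point function (1.14a). -/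
theorem three_point_from_four_point (l : ℕ) (z₁ z₂ w : ℝ)
    (h1 : w ≠ z₁) (h2 : w ≠ z₂) :
    (-1 : ℝ) ^ l *
        (pd1^[l] (pd2^[l] fun p : ℝ × ℝ =>
          (p.1 - p.2) ^ l / ((z₁ - p.2) * (z₂ - p.1)))) (w, w) =
      (Nat.factorial l : ℝ) ^ 2 * (z₁ - z₂) ^ l /
        ((z₁ - w) * (z₂ - w)) ^ (l + 1) := by
  have hinner : ∀ x : ℝ, iteratedDeriv l
      (fun y => (x - y) ^ l / ((z₁ - y) * (z₂ - x))) w =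
        l.factorial / (z₁ - w) ^ (l + 1) * ((x - z₁) ^ l / (z₂ - x)) := by
    intro x
    have hfun : (fun y => (x - y) ^ l / ((z₁ - y) * (z₂ - x))) =
        fun y => ((-1) ^ l / (z₂ - x)) * ((y - x) ^ l / (z₁ - y)) := by
      ext y
      rw [← neg_sub y x, neg_pow, mul_comm (z₁ - y), mul_div_mul_comm]
    rw [hfun, iteratedDeriv_const_mul_field, iteratedDeriv_sub_pow_div_sub l x z₁ h1,
      ← neg_sub z₁ x, neg_pow (z₁ - x)]
    ring
  simp only [pd1_iterate, pd2_iterate, hinner]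
  rw [iteratedDeriv_const_mul_field, iteratedDeriv_sub_pow_div_sub l z₁ z₂ h2,
    ← neg_sub z₂ z₁, neg_pow (z₂ - z₁), mul_pow (z₁ - w)]
  field_simp
end
end
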